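/- Let D ⊆ ℂ be a generalized Jordan domain and let φ : D → Ω be a homeomorphism of D onto a bounded domain Ω ⊆ ℂ. Then φ admits a continuous extension φ̄ : closure(D) → closure(Ω) (a continuous map on closure(D) that agrees with φ on D and takes values in closure(Ω)) if and only if both of the following hold: (1) ∂Ω is a Peano compactum; (2) for every z₀ ∈ ∂D, liminf_{r→0⁺} σ_r(z₀) = 0. -/

import Mathlib

open Set Metric Filter MeasureTheory Topology

noncomputable section

/-- A planar domain: a nonempty open connected subset of ℂ. -/
def IsPlanarDomain (D : Set ℂ) : Prop := D.Nonempty ∧ IsOpen D ∧ IsConnected D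

/-- A Peano compactum: a compact subset of ℂ all of whose connected components are
locally connected (as subspaces of ℂ) and such that for every `C > 0` only finitely
many components have diameter greater than `C`. -/
def IsPeanoCompactum (K : Set ℂ) : Prop :=
  IsCompact K ∧
  (∀ x ∈ K, LocallyConnectedSpace ↥(connectedComponentIn K x)) ∧
  ∀ C : ℝ, 0 < C →
    {Q : Set ℂ | (∃ x ∈ K, Q = connectedComponentIn K x) ∧ C < Metric.diam Q}.Finite

/-- A Jordan curve: a subset of ℂ homeomorphic to the unit circle. -/
def IsJordanCurve (J : Set ℂ) : Prop :=
  Nonempty (↥J ≃ₜ ↥(Metric.sphere (0:ℂ) 1))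

/-- A generalized Jordan domain: a bounded domain whose boundary is a Peano compactum,
each of whose boundary components is a single point or a Jordan curve. -/
def IsGeneralizedJordanDomain (D : Set ℂ) : Prop :=
  IsPlanarDomain D ∧ Bornology.IsBounded D ∧
  IsPeanoCompactum (frontier D) ∧
  ∀ x ∈ frontier D,
    connectedComponentIn (frontier D) x = {x} ∨
    IsJordanCurve (connectedComponentIn (frontier D) x)

/-- `φ` restricts to a homeomorphism of `D` onto `Ω`. -/
def IsHomeoOnto (φ : ℂ → ℂ) (D Ω : Set ℂ) : Prop :=
  ContinuousOn φ D ∧ Set.BijOn φ D Ω ∧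
  ∃ ψ : ℂ → ℂ, ContinuousOn ψ Ω ∧ Set.InvOn ψ φ D Ω

/-- `φ` is a conformal homeomorphism (holomorphic bijection) of `D` onto `Ω`. -/
def IsConformalHomeoOnto (φ : ℂ → ℂ) (D Ω : Set ℂ) : Prop :=
  DifferentiableOn ℂ φ D ∧ Set.BijOn φ D Ω

/-- `φb` is a continuous extension of `φ : D → Ω` to `closure D`, with values in `closure Ω`. -/
def ExtendsContinuously (φ φb : ℂ → ℂ) (D Ω : Set ℂ) : Prop :=
  ContinuousOn φb (closure D) ∧ Set.EqOn φb φ D ∧ Set.MapsTo φb (closure D) (closure Ω)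

/-- The oscDiam `σ_r(z₀) = diam φ(D ∩ C_r(z₀))`. -/
def oscDiam (φ : ℂ → ℂ) (D : Set ℂ) (z₀ : ℂ) (r : ℝ) : ℝ :=
  Metric.diam (φ '' (D ∩ Metric.sphere z₀ r))

/-- `liminf_{r→0⁺} σ_r(z₀) = 0`. -/
def OscLiminfZero (φ : ℂ → ℂ) (D : Set ℂ) (z₀ : ℂ) : Prop :=
  Filter.liminf (oscDiam φ D z₀) (nhdsWithin (0:ℝ) (Set.Ioi 0)) = 0

/-- A circle domain (normalized so that ∞ lies in a complementary disk): every bounded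
complementary component is a point or a closed round disk, and the unbounded
complementary component is the complement of an open round disk. -/
def IsCircleDomain (D : Set ℂ) : Prop :=
  IsPlanarDomain D ∧ Bornology.IsBounded D ∧
  ∀ x ∈ Dᶜ,
    (Bornology.IsBounded (connectedComponentIn Dᶜ x) →
      connectedComponentIn Dᶜ x = {x} ∨
      ∃ c : ℂ, ∃ rad : ℝ, 0 < rad ∧ connectedComponentIn Dᶜ x = Metric.closedBall c rad) ∧
    (¬ Bornology.IsBounded (connectedComponentIn Dᶜ x) →
      ∃ c : ℂ, ∃ rad : ℝ, 0 < rad ∧ connectedComponentIn Dᶜ x = (Metric.ball c rad)ᶜ)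

/-- A set has σ-finite linear (1-dimensional Hausdorff) measure. -/
def SigmaFiniteH1 (E : Set ℂ) : Prop :=
  ∃ f : ℕ → Set ℂ, (⋃ n, f n) = E ∧ ∀ n, μH[1] (f n) < ⊤

/-- The set of connected components of `K` containing more than one point. -/
def NondegComponents (K : Set ℂ) : Set (Set ℂ) :=
  {Q | (∃ x ∈ K, Q = connectedComponentIn K x) ∧ ∃ a ∈ Q, ∃ b ∈ Q, a ≠ b}

/-- The union of the singleton connected components of `K`. -/
def SingletonPart (K : Set ℂ) : Set ℂ :=
  {x | x ∈ K ∧ connectedComponentIn K x = {x}}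

/-- The cluster set `C(h, z₀) = ⋂_{r>0} closure h({z ∈ U : |z − z₀| < r})`. -/
def clusterSet (h : ℂ → ℂ) (U : Set ℂ) (z₀ : ℂ) : Set ℂ :=
  ⋂ r ∈ Set.Ioi (0:ℝ), closure (h '' (U ∩ Metric.ball z₀ r))

/-- The boundary component of `Ω` corresponding (under `φ : D → Ω`) to a boundary
component `Q` of `D`: `φ^B(Q) = ⋃_{z ∈ Q} C(φ, z)`. -/
def boundaryComp (φ : ℂ → ℂ) (D : Set ℂ) (Q : Set ℂ) : Set ℂ :=
  ⋃ z ∈ Q, clusterSet φ D z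

/-- An arc: the image of a continuous injective map from `[0,1]`. -/
def IsArc (A : Set ℂ) : Prop :=
  ∃ f : ℝ → ℂ, ContinuousOn f (Set.Icc 0 1) ∧ Set.InjOn f (Set.Icc 0 1) ∧
    f '' Set.Icc 0 1 = A

/-- An arc from `a` to `b`. -/
def IsArcFromTo (A : Set ℂ) (a b : ℂ) : Prop :=
  ∃ f : ℝ → ℂ, ContinuousOn f (Set.Icc 0 1) ∧ Set.InjOn f (Set.Icc 0 1) ∧
    f '' Set.Icc 0 1 = A ∧ f 0 = a ∧ f 1 = b

/-- Property S: for every `ε > 0`, `Ω` is a finite union of connected sets of diameter `< ε`. -/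
def PropertyS (Ω : Set ℂ) : Prop :=
  ∀ ε > (0:ℝ), ∃ (k : ℕ) (N : Fin k → Set ℂ),
    (∀ i, IsConnected (N i) ∧ Metric.diam (N i) < ε) ∧ (⋃ i, N i) = Ω

/-- `x ∈ ∂Ω` is locally accessible from `Ω`. -/
def LocallyAccessible (Ω : Set ℂ) (x : ℂ) : Prop :=
  ∀ ε > (0:ℝ), ∃ δ > (0:ℝ), ∀ z ∈ Ω, dist z x < δ →
    ∃ A : Set ℂ, IsArcFromTo A z x ∧ A ⊆ Ω ∪ {x} ∧ Metric.diam A < ε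

/-- `ξ ∈ ∂Ω` is locally sequentially accessible. -/
def LocallySeqAccessible (Ω : Set ℂ) (ξ : ℂ) : Prop :=
  ∀ r > (0:ℝ), ∀ ξn : ℕ → ℂ, (∀ n, ξn n ∈ Ω) → Filter.Tendsto ξn Filter.atTop (nhds ξ) →
    ∃ x ∈ Ω ∩ Metric.ball ξ r,
      {n : ℕ | ξn n ∈ connectedComponentIn (Ω ∩ Metric.ball ξ r) x}.Infinite

/-- `Ω` is finitely connected at the boundary point `x`. -/
def FinitelyConnectedAt (Ω : Set ℂ) (x : ℂ) : Prop :=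
  ∀ r > (0:ℝ), ∃ U : Set ℂ, IsOpen U ∧ x ∈ U ∧ U ⊆ Metric.ball x r ∧
    {Q : Set ℂ | ∃ y ∈ U ∩ Ω, Q = connectedComponentIn (U ∩ Ω) y}.Finite

/-- The diameter (Mazurkiewicz) distance on `Ω`. -/
def mazDist (Ω : Set ℂ) (x y : ℂ) : ℝ :=
  sInf (Metric.diam '' {E : Set ℂ | E ⊆ Ω ∧ IsConnected E ∧ x ∈ E ∧ y ∈ E})

/-- `Ω` is totally bounded for the Mazurkiewicz distance; for a metric space this is
equivalent to compactness of the metric completion of `(Ω, mazDist)`. -/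
def MazCompletionCompact (Ω : Set ℂ) : Prop :=
  ∀ ε > (0:ℝ), ∃ F : Finset ℂ, ↑F ⊆ Ω ∧ ∀ x ∈ Ω, ∃ y ∈ F, mazDist Ω x y < ε

/-- `f : A → B` is non-alternating: there are no `x, y ∈ B` and no separation of
`A \ f⁻¹({x})` into two disjoint nonempty relatively open sets `A₁, A₂` with
`y ∈ f(A₁) ∩ f(A₂)`. -/
def NonAlternatingOn (f : ℂ → ℂ) (A B : Set ℂ) : Prop :=
  ¬ ∃ x ∈ B, ∃ y ∈ B, ∃ A₁ A₂ : Set ℂ,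
      A₁.Nonempty ∧ A₂.Nonempty ∧ Disjoint A₁ A₂ ∧
      A₁ ∪ A₂ = {z | z ∈ A ∧ f z ≠ x} ∧
      (∃ U₁ : Set ℂ, IsOpen U₁ ∧ A₁ = U₁ ∩ {z | z ∈ A ∧ f z ≠ x}) ∧
      (∃ U₂ : Set ℂ, IsOpen U₂ ∧ A₂ = U₂ ∩ {z | z ∈ A ∧ f z ≠ x}) ∧
      y ∈ f '' A₁ ∧ y ∈ f '' A₂

/-! ### Preconnected sets, frontiers and components -/

theorem IsPreconnected.subset_or_subset_compl_of_disjoint_frontier {X : Type*} [TopologicalSpace X]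
    {s t : Set X} (hs : IsPreconnected s) (hst : Disjoint s (frontier t)) : s ⊆ t ∨ s ⊆ tᶜ := by
  have hcl : ∀ x ∈ s, x ∈ t → x ∈ interior t := fun x hx hxt => by
    by_contra h
    exact hst.le_bot ⟨hx, subset_closure hxt, h⟩
  have hcl' : ∀ x ∈ s, x ∉ t → x ∈ (closure t)ᶜ := fun x hx hxt h =>
    hst.le_bot ⟨hx, h, fun h' => hxt (interior_subset h')⟩
  rcases hs.subset_or_subset isOpen_interior isClosed_closure.isOpen_compl
    (disjoint_compl_right.mono_left interior_subset_closure) (fun x hx => by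
      by_cases hxt : x ∈ t
      · exact Or.inl (hcl x hx hxt)
      · exact Or.inr (hcl' x hx hxt)) with h | h
  · exact Or.inl (h.trans interior_subset)
  · exact Or.inr (h.trans (compl_subset_compl.2 subset_closure))

theorem IsPreconnected.subset_of_disjoint_frontier {X : Type*} [TopologicalSpace X]
    {s t : Set X} {x : X} (hs : IsPreconnected s) (hst : Disjoint s (frontier t))
    (hxs : x ∈ s) (hxt : x ∈ t) : s ⊆ t :=
  (hs.subset_or_subset_compl_of_disjoint_frontier hst).resolve_right fun h => h hxs hxt

theorem IsPreconnected.subset_ball_of_disjoint_sphere {s : Set ℂ} {a x : ℂ} {r : ℝ} (hr : r ≠ 0)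
    (hs : IsPreconnected s) (hsd : Disjoint s (sphere a r)) (hxs : x ∈ s) (hxr : x ∈ ball a r) :
    s ⊆ ball a r :=
  hs.subset_of_disjoint_frontier (by rwa [frontier_ball a hr]) hxs hxr

theorem disjoint_closure_connectedComponentIn_compl {X : Set ℂ} (hX : IsClosed X) {x y : ℂ}
    (hy : y ∉ X) (hxy : y ∉ connectedComponentIn Xᶜ x) :
    y ∉ closure (connectedComponentIn Xᶜ x) := by
  intro h
  obtain ⟨z, hzy, hzx⟩ := mem_closure_iff.1 h _ (hX.isOpen_compl.connectedComponentIn (x := y))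
    (mem_connectedComponentIn hy)
  rw [connectedComponentIn_eq hzx, ← connectedComponentIn_eq hzy] at hxy
  exact hxy (mem_connectedComponentIn hy)

theorem frontier_connectedComponentIn_compl_subset {X : Set ℂ} (hX : IsClosed X) (x : ℂ) :
    frontier (connectedComponentIn Xᶜ x) ⊆ X := by
  intro y hy
  by_contra hyX
  rw [(hX.isOpen_compl.connectedComponentIn).frontier_eq] at hy
  exact disjoint_closure_connectedComponentIn_compl hX hyX hy.2 hy.1

theorem isPreconnected_compl_closedBall (c : ℂ) {R : ℝ} (hR : 0 < R) :
    IsPreconnected (closedBall c R)ᶜ := by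
  have himg : (closedBall c R)ᶜ = (fun w => c + Complex.exp w) '' {w : ℂ | Real.log R < w.re} := by
    ext z
    simp only [mem_compl_iff, mem_closedBall, not_le, mem_image, mem_ofPred_eq, dist_eq_norm]
    constructor
    · intro hz
      have hne : z - c ≠ 0 := norm_pos_iff.1 (hR.trans hz)
      refine ⟨Complex.log (z - c), ?_, by rw [Complex.exp_log hne]; ring⟩
      rw [Complex.log_re]
      exact Real.log_lt_log hR hz
    · rintro ⟨w, hw, rfl⟩
      rw [add_sub_cancel_left, Complex.norm_exp]
      exact (Real.log_lt_iff_lt_exp hR).1 hw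
  rw [himg]
  exact (convex_halfSpace_re_gt _).isPreconnected.image _ (by fun_prop)

theorem isBounded_connectedComponentIn_compl_or {X : Set ℂ} (hX : IsCompact X) {x y : ℂ}
    (hxy : y ∉ connectedComponentIn Xᶜ x) :
    Bornology.IsBounded (connectedComponentIn Xᶜ x) ∨
      Bornology.IsBounded (connectedComponentIn Xᶜ y) := by
  obtain ⟨R, hR, hXR⟩ := hX.isBounded.subset_closedBall_lt 0 0
  by_contra! h
  have key : ∀ w : ℂ, ¬ Bornology.IsBounded (connectedComponentIn Xᶜ w) →
      ∃ p ∈ connectedComponentIn Xᶜ w, p ∈ (closedBall (0 : ℂ) R)ᶜ := by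
    intro w hw
    by_contra! h'
    exact hw (isBounded_closedBall.subset fun p hp => not_not.1 (h' p hp))
  obtain ⟨p, hpx, hpR⟩ := key x h.1
  obtain ⟨q, hqy, hqR⟩ := key y h.2
  have hpq : q ∈ connectedComponentIn Xᶜ p :=
    (isPreconnected_compl_closedBall 0 hR).subset_connectedComponentIn hpR
      (compl_subset_compl.2 hXR) hqR
  rw [connectedComponentIn_eq hpx] at hxy
  have hyX : y ∈ Xᶜ := connectedComponentIn_nonempty_iff.1 ⟨q, hqy⟩
  rw [connectedComponentIn_eq hpq, ← connectedComponentIn_eq hqy] at hxy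
  exact hxy (mem_connectedComponentIn hyX)

/-! ### Continuous logarithms -/

theorem exists_continuous_log {F : ℂ → ℂ} (hF : Continuous F) (h0 : ∀ z, F z ≠ 0) :
    ∃ L : ℂ → ℂ, Continuous L ∧ ∀ z, Complex.exp (L z) = F z := by
  obtain ⟨L, ⟨-, hL⟩, -⟩ := Complex.isCoveringMapOn_exp.existsUnique_continuousMap_lifts
    (⟨F, hF⟩ : C(ℂ, ℂ)) (a₀ := 0) (e₀ := Complex.log (F 0)) (Complex.exp_log (h0 0)) h0
  exact ⟨L, L.continuous, fun z => congrFun hL z⟩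

theorem IsPreconnected.eqOn_of_exp_eq {X : Type*} [TopologicalSpace X] {s : Set X}
    (hs : IsPreconnected s) {f g : X → ℂ} (hf : ContinuousOn f s) (hg : ContinuousOn g s)
    (h : ∀ x ∈ s, Complex.exp (f x) = Complex.exp (g x)) {p : X} (hp : p ∈ s)
    (hfg : f p = g p) : EqOn f g s := by
  have hex : ∀ x ∈ s, ∃ n : ℤ, f x - g x = n * (2 * Real.pi * Complex.I) := fun x hx => by
    obtain ⟨n, hn⟩ := Complex.exp_eq_exp_iff_exists_int.1 (h x hx)
    exact ⟨n, by rw [hn]; ring⟩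
  have hpi : (2 * Real.pi * Complex.I : ℂ) ≠ 0 := Complex.two_pi_I_ne_zero
  have hd : ContinuousOn (fun x => ((f x - g x) / (2 * Real.pi * Complex.I)).re) s :=
    Complex.continuous_re.comp_continuousOn ((hf.sub hg).div_const _)
  have hmaps : MapsTo (fun x => ((f x - g x) / (2 * Real.pi * Complex.I)).re) s
      (range ((↑) : ℤ → ℝ)) := by
    intro x hx
    obtain ⟨n, hn⟩ := hex x hx
    exact ⟨n, by simp only [hn]; rw [mul_div_cancel_right₀ _ hpi]; simp⟩
  intro x hx
  have hc := hs.constant_of_mapsTo (Int.isClosedEmbedding_coe_real.isEmbedding.isDiscrete_range)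
    hd hmaps hx hp
  obtain ⟨n, hn⟩ := hex x hx
  simp only [hn, hfg, sub_self, zero_div, Complex.zero_re] at hc
  rw [mul_div_cancel_right₀ _ hpi] at hc
  have : n = 0 := by exact_mod_cast hc
  rw [this] at hn
  simpa [sub_eq_zero] using hn

/-- If `(z - x) ^ n` coincides outside a bounded set with a continuous function which has no zero
in the plane, then `n = 0`. -/
theorem eq_zero_of_continuous_of_eq_zpow {F : ℂ → ℂ} (hF : Continuous F) (h0 : ∀ z, F z ≠ 0)
    {x : ℂ} {n : ℤ} {R : ℝ} (hR : 0 < R) (h : ∀ z ∈ sphere x R, F z = (z - x) ^ n) : n = 0 := by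
  obtain ⟨L, hL, hLF⟩ := exists_continuous_log hF h0
  have hRC : (R : ℂ) ≠ 0 := by exact_mod_cast hR.ne'
  have hpath : ∀ t : ℝ, Complex.exp (L (x + R * Complex.exp (t * Complex.I))) =
      Complex.exp (n * (t * Complex.I) + L (x + R)) := by
    intro t
    have hmem : ∀ t : ℝ, x + R * Complex.exp (t * Complex.I) ∈ sphere x R := fun t => by
      simp [Complex.norm_exp_ofReal_mul_I, abs_of_pos hR]
    have h1 := hmem 0
    simp only [Complex.ofReal_zero, zero_mul, Complex.exp_zero, mul_one] at h1
    rw [Complex.exp_add, hLF, hLF, h _ (hmem t), h _ h1, Complex.exp_int_mul]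
    simp only [add_sub_cancel_left]
    rw [mul_zpow, mul_comm]
  have heq := isPreconnected_univ.eqOn_of_exp_eq
    (f := fun t : ℝ => L (x + R * Complex.exp (t * Complex.I)))
    (g := fun t : ℝ => n * (t * Complex.I) + L (x + R))
    (by fun_prop) (by fun_prop) (fun t _ => hpath t) (mem_univ 0) (by simp)
    (mem_univ (2 * Real.pi))
  have hexp : Complex.exp (2 * Real.pi * Complex.I) = 1 := Complex.exp_two_pi_mul_I
  simp only [Complex.ofReal_mul, Complex.ofReal_ofNat, hexp, mul_one] at heq
  have : (n : ℂ) * (2 * Real.pi * Complex.I) = 0 := by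
    linear_combination -heq
  simpa [Complex.two_pi_I_ne_zero] using this

/-- If, on a compact set, `(z - x) ^ n` differs by an exponential from a function which has no zero
on the closure of the bounded complementary component containing `x`, then `n = 0`. -/
theorem eq_zero_of_exp_mul_eq_zpow {X : Set ℂ} (hX : IsClosed X) {x : ℂ} (hx : x ∉ X)
    (hb : Bornology.IsBounded (connectedComponentIn Xᶜ x)) {n : ℤ} {f L : ℂ → ℂ}
    (hf : ContinuousOn f (closure (connectedComponentIn Xᶜ x)))
    (hf0 : ∀ z ∈ closure (connectedComponentIn Xᶜ x), f z ≠ 0)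
    (hL : ContinuousOn L X) (h : ∀ z ∈ X, Complex.exp (L z) * f z = (z - x) ^ n) : n = 0 := by
  classical
  set U := connectedComponentIn Xᶜ x
  have hxU : x ∈ U := mem_connectedComponentIn hx
  have hUo : IsOpen U := hX.isOpen_compl.connectedComponentIn
  obtain ⟨M, hM⟩ := ContinuousMap.exists_restrict_eq hX (⟨X.domRestrict L, hL.domRestrict⟩ : C(X, ℂ))
  have hML : ∀ z ∈ X, M z = L z := fun z hz => congrArg (fun k : C(X, ℂ) => k ⟨z, hz⟩) hM
  have hfr : frontier U ⊆ X := frontier_connectedComponentIn_compl_subset hX x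
  have hne : ∀ z ∉ U, z - x ≠ 0 := fun z hz h' => hz (by rwa [sub_eq_zero.1 h'])
  set F : ℂ → ℂ := U.piecewise (fun z => Complex.exp (M z) * f z) (fun z => (z - x) ^ n)
  have hF : Continuous F := by
    rw [← continuousOn_univ]
    refine ContinuousOn.piecewise (fun a ha => ?_) ?_ ?_
    · rw [hML a (hfr ha.2), h a (hfr ha.2)]
    · rw [univ_inter]
      exact (by fun_prop : Continuous fun z => Complex.exp (M z)).continuousOn.mul hf
    · rw [univ_inter, hUo.isClosed_compl.closure_eq]
      exact (by fun_prop : Continuous fun z : ℂ => z - x).continuousOn.zpow₀ n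
        fun z hz => Or.inl (hne z hz)
  have hF0 : ∀ z, F z ≠ 0 := by
    intro z
    by_cases hz : z ∈ U
    · simp only [F, piecewise_eq_of_mem _ _ _ hz]
      exact mul_ne_zero (Complex.exp_ne_zero _) (hf0 z (subset_closure hz))
    · simp only [F, piecewise_eq_of_notMem _ _ _ hz]
      exact zpow_ne_zero _ (hne z hz)
  obtain ⟨R, hR, hUR⟩ := hb.subset_ball_lt 0 x
  refine eq_zero_of_continuous_of_eq_zpow (x := x) hF hF0 hR fun z hz => ?_
  refine piecewise_eq_of_notMem _ _ _ fun hzU => ?_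
  exact (mem_ball.1 (hUR hzU)).ne hz

theorem exists_continuousOn_log_div {U K : Set ℂ} (hUo : IsOpen U) (hU : IsPreconnected U)
    (hUK : Disjoint U K) {x y : ℂ} (hx : x ∈ U) (hy : y ∈ U) :
    ∃ L : ℂ → ℂ, ContinuousOn L K ∧ ∀ z ∈ K, Complex.exp (L z) = (z - x) / (z - y) := by
  have hne : ∀ w ∈ U, ∀ z ∈ K, z - w ≠ 0 := fun w hw z hz h =>
    hUK.le_bot ⟨hw, by rwa [← sub_eq_zero.1 h]⟩
  have hloc : ∀ w ∈ U, ∃ ρ > 0, ∀ v ∈ ball w ρ, v ∈ U ∧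
      ∃ L : ℂ → ℂ, ContinuousOn L K ∧ ∀ z ∈ K, Complex.exp (L z) = (z - v) / (z - w) := by
    intro w hw
    obtain ⟨ρ, hρ, hρU⟩ := Metric.isOpen_iff.1 hUo w hw
    refine ⟨ρ, hρ, fun v hv => ⟨hρU hv, fun z => Complex.log ((z - v) / (z - w)), ?_, ?_⟩⟩
    · refine ContinuousOn.clog ?_ fun z hz => ?_
      · exact ContinuousOn.div (by fun_prop) (by fun_prop) (hne w hw)
      · have hz' : ρ ≤ ‖z - w‖ := by
          by_contra! h'
          exact hUK.le_bot ⟨hρU (mem_ball_iff_norm.2 h'), hz⟩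
        have hnorm : ‖(w - v) / (z - w)‖ < 1 := by
          rw [norm_div, div_lt_one (hρ.trans_le hz'), norm_sub_rev]
          exact (mem_ball_iff_norm.1 hv).trans_le hz'
        have : (z - v) / (z - w) = 1 + (w - v) / (z - w) := by
          field_simp [hne w hw z hz]
          ring
        rw [this]
        exact Complex.mem_slitPlane_of_norm_lt_one hnorm
    · exact fun z hz => Complex.exp_log (div_ne_zero (hne v (hρU hv) z hz) (hne w hw z hz))
  set P : ℂ → Prop := fun v =>
    ∃ L : ℂ → ℂ, ContinuousOn L K ∧ ∀ z ∈ K, Complex.exp (L z) = (z - v) / (z - y)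
  have hstep : ∀ w ∈ U, ∀ v ∈ U, (∃ L : ℂ → ℂ, ContinuousOn L K ∧
      ∀ z ∈ K, Complex.exp (L z) = (z - v) / (z - w)) → (P w ↔ P v) := by
    rintro w hw v hv ⟨L, hL, hLe⟩
    constructor
    · rintro ⟨M, hM, hMe⟩
      refine ⟨fun z => L z + M z, hL.add hM, fun z hz => ?_⟩
      rw [Complex.exp_add, hLe z hz, hMe z hz, div_mul_div_cancel₀ (hne w hw z hz)]
    · rintro ⟨M, hM, hMe⟩
      refine ⟨fun z => M z - L z, hM.sub hL, fun z hz => ?_⟩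
      rw [Complex.exp_sub, hLe z hz, hMe z hz]
      have := hne w hw z hz
      have := hne v hv z hz
      have := hne y hy z hz
      field_simp
  have hopen : ∀ Q : ℂ → Prop, (Q = P ∨ Q = fun v => ¬ P v) → IsOpen {v | v ∈ U ∧ Q v} := by
    intro Q hQ
    rw [Metric.isOpen_iff]
    rintro w ⟨hw, hQw⟩
    obtain ⟨ρ, hρ, hb⟩ := hloc w hw
    refine ⟨ρ, hρ, fun v hv => ⟨(hb v hv).1, ?_⟩⟩
    have := hstep w hw v (hb v hv).1 (hb v hv).2
    rcases hQ with rfl | rfl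
    · exact this.1 hQw
    · exact fun h => hQw (this.2 h)
  have hPy : P y := ⟨fun _ => 0, continuousOn_const, fun z hz => by
    rw [Complex.exp_zero, div_self (hne y hy z hz)]⟩
  have hsub := hU.subset_left_of_subset_union (hopen _ (Or.inl rfl)) (hopen _ (Or.inr rfl))
    (disjoint_left.2 fun v h1 h2 => h2.2 h1.2)
    (fun v hv => by
      by_cases h : P v
      · exact Or.inl ⟨hv, h⟩
      · exact Or.inr ⟨hv, h⟩) ⟨y, hy, hy, hPy⟩
  exact (hsub hx).2

/-- **Janiszewski's theorem** for disjoint compact sets. -/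
theorem mem_connectedComponentIn_compl_union {K₁ K₂ : Set ℂ} (h₁ : IsCompact K₁)
    (h₂ : IsCompact K₂) (hd : Disjoint K₁ K₂) {x y : ℂ} (hx₁ : y ∈ connectedComponentIn K₁ᶜ x)
    (hx₂ : y ∈ connectedComponentIn K₂ᶜ x) : y ∈ connectedComponentIn (K₁ ∪ K₂)ᶜ x := by
  classical
  by_contra hxy
  have hx1 : x ∈ K₁ᶜ := connectedComponentIn_nonempty_iff.1 ⟨y, hx₁⟩
  have hx2 : x ∈ K₂ᶜ := connectedComponentIn_nonempty_iff.1 ⟨y, hx₂⟩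
  have hy1 : y ∈ K₁ᶜ := connectedComponentIn_subset _ _ hx₁
  have hy2 : y ∈ K₂ᶜ := connectedComponentIn_subset _ _ hx₂
  have hlog : ∀ K : Set ℂ, IsCompact K → x ∈ Kᶜ → y ∈ connectedComponentIn Kᶜ x →
      ∃ L : ℂ → ℂ, ContinuousOn L K ∧ ∀ z ∈ K, Complex.exp (L z) = (z - x) / (z - y) :=
    fun K hK hx hy => exists_continuousOn_log_div hK.isClosed.isOpen_compl.connectedComponentIn
      isPreconnected_connectedComponentIn
      (disjoint_compl_left.mono_left (connectedComponentIn_subset _ _))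
      (mem_connectedComponentIn hx) hy
  obtain ⟨L₁, hL₁, he₁⟩ := hlog K₁ h₁ hx1 hx₁
  obtain ⟨L₂, hL₂, he₂⟩ := hlog K₂ h₂ hx2 hx₂
  set L : ℂ → ℂ := K₁.piecewise L₁ L₂
  have hLK₁ : EqOn L L₁ K₁ := piecewise_eqOn _ _ _
  have hLK₂ : EqOn L L₂ K₂ := (piecewise_eqOn_compl K₁ L₁ L₂).mono hd.subset_compl_left
  have hL : ContinuousOn L (K₁ ∪ K₂) :=
    (hL₁.congr hLK₁).union_of_isClosed (hL₂.congr hLK₂) h₁.isClosed h₂.isClosed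
  have hX : IsCompact (K₁ ∪ K₂) := h₁.union h₂
  have hxX : x ∉ K₁ ∪ K₂ := fun h => h.elim hx1 hx2
  have hyX : y ∉ K₁ ∪ K₂ := fun h => h.elim hy1 hy2
  have he : ∀ z ∈ K₁ ∪ K₂, Complex.exp (L z) = (z - x) / (z - y) := by
    rintro z (hz | hz)
    · rw [hLK₁ hz, he₁ z hz]
    · rw [hLK₂ hz, he₂ z hz]
  have hne : ∀ w ∉ K₁ ∪ K₂, ∀ z ∈ K₁ ∪ K₂, z - w ≠ 0 := fun w hw z hz h =>
    hw (by rwa [← sub_eq_zero.1 h])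
  rcases isBounded_connectedComponentIn_compl_or hX hxy with hb | hb
  · have hyc := disjoint_closure_connectedComponentIn_compl hX.isClosed hyX hxy
    have := eq_zero_of_exp_mul_eq_zpow hX.isClosed hxX hb (n := 1) (f := fun z => z - y)
      (by fun_prop) (fun z hz h => hyc (by rwa [← sub_eq_zero.1 h])) hL
      (fun z hz => by rw [he z hz, zpow_one, div_mul_cancel₀ _ (hne y hyX z hz)])
    exact one_ne_zero this
  · have hyx : x ∉ connectedComponentIn (K₁ ∪ K₂)ᶜ y := fun h => hxy (by
      rw [← connectedComponentIn_eq h]; exact mem_connectedComponentIn hyX)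
    have hxc := disjoint_closure_connectedComponentIn_compl hX.isClosed hxX hyx
    have := eq_zero_of_exp_mul_eq_zpow hX.isClosed hyX hb (n := 1) (f := fun z => z - x)
      (by fun_prop) (fun z hz h => hxc (by rwa [← sub_eq_zero.1 h])) hL.neg
      (fun z hz => by
        have := hne x hxX z hz
        have := hne y hyX z hz
        rw [Pi.neg_apply, Complex.exp_neg, he z hz, zpow_one]
        field_simp)
    exact one_ne_zero this

/-! ### Separating compact sets -/

theorem IsCompact.exists_separation_of_components {X : Type*} [TopologicalSpace X] [T2Space X]
    {K S T : Set X} (hK : IsCompact K) (hS : IsCompact S) (hT : IsClosed T) (hSK : S ⊆ K)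
    (h : ∀ s ∈ S, Disjoint (connectedComponentIn K s) T) :
    ∃ A B : Set X, IsCompact A ∧ IsCompact B ∧ Disjoint A B ∧ A ∪ B = K ∧ S ⊆ A ∧
      Disjoint A T := by
  have : CompactSpace K := isCompact_iff_compactSpace.1 hK
  have hT' : IsCompact (((↑) : K → X) ⁻¹' T) :=
    (hT.preimage continuous_subtype_val).isCompact
  have hpt : ∀ s : K, (s : X) ∈ S → ∃ C : Set K, IsClopen C ∧ s ∈ C ∧
      Disjoint C (((↑) : K → X) ⁻¹' T) := by
    intro s hs
    have hcc : Disjoint (connectedComponent s) (((↑) : K → X) ⁻¹' T) := by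
      rw [disjoint_left]
      intro t ht htT
      refine (h s hs).le_bot ⟨?_, htT⟩
      rw [connectedComponentIn_eq_image s.2]
      exact ⟨t, ht, rfl⟩
    rw [connectedComponent_eq_iInter_isClopen, disjoint_iff_inter_eq_empty, inter_comm] at hcc
    obtain ⟨u, hu⟩ := hT'.elim_finite_subfamily_closed
      (fun C : { C : Set K // IsClopen C ∧ s ∈ C } => (C : Set K)) (fun C => C.2.1.isClosed) hcc
    refine ⟨⋂ C ∈ u, (C : Set K), isClopen_biInter_finset fun C _ => C.2.1,
      mem_iInter₂.2 fun C _ => C.2.2, ?_⟩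
    rw [disjoint_iff_inter_eq_empty, inter_comm]
    exact hu
  choose! C hCc hCs hCT using hpt
  have hS' : IsCompact (((↑) : K → X) ⁻¹' S) :=
    (hS.isClosed.preimage continuous_subtype_val).isCompact
  obtain ⟨t, htS, ht⟩ := hS'.elim_nhds_subcover C
    (fun s hs => (hCc s hs).isOpen.mem_nhds (hCs s hs))
  set A : Set K := ⋃ s ∈ t, C s
  have hA : IsClopen A := isClopen_biUnion_finset fun s hs => hCc s (htS s hs)
  refine ⟨(↑) '' A, (↑) '' Aᶜ, hA.isClosed.isCompact.image continuous_subtype_val,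
    hA.compl.isClosed.isCompact.image continuous_subtype_val,
    (disjoint_image_iff Subtype.val_injective).2 disjoint_compl_right, ?_, ?_, ?_⟩
  · rw [← image_union, union_compl_self, image_univ, Subtype.range_coe]
  · exact fun s hs => ⟨⟨s, hSK hs⟩, ht hs, rfl⟩
  · rw [disjoint_left]
    rintro _ ⟨x, hx, rfl⟩ hxT
    obtain ⟨s, hs, hxs⟩ := mem_iUnion₂.1 hx
    exact (hCT s (htS s hs)).le_bot ⟨hxs, hxT⟩

theorem exists_isCompact_separating {D : Set ℂ} (hDo : IsOpen D) (hDc : IsPreconnected D)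
    (hDb : Bornology.IsBounded D) {z₁ z₂ : ℂ} (h₁ : z₁ ∈ frontier D) (h₂ : z₂ ∈ frontier D)
    (h : z₂ ∉ connectedComponentIn (frontier D) z₁) :
    ∃ J : Set ℂ, IsCompact J ∧ J ⊆ D ∧ z₂ ∉ connectedComponentIn Jᶜ z₁ := by
  have hF : IsCompact (frontier D) :=
    hDb.isCompact_closure.of_isClosed_subset isClosed_frontier frontier_subset_closure
  obtain ⟨A, B, hA, hB, hAB, hABF, h1A, h2A⟩ := hF.exists_separation_of_components
    (S := {z₁}) (T := {z₂}) isCompact_singleton isClosed_singleton (singleton_subset_iff.2 h₁)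
    (by simpa using h)
  have h2B : z₂ ∈ B := by
    rw [← hABF] at h₂
    exact h₂.resolve_left fun h' => h2A.le_bot ⟨h', rfl⟩
  obtain ⟨V, hVo, hAV, hVB, hVc⟩ := exists_open_between_and_isCompact_closure hA
    hB.isClosed.isOpen_compl hAB.subset_compl_right
  have hVF : Disjoint (frontier V) (frontier D) := by
    rw [← hABF, hVo.frontier_eq, disjoint_left]
    rintro z ⟨hz, hzV⟩ (hzA | hzB)
    · exact hzV (hAV hzA)
    · exact hVB hz hzB
  have hfV : IsCompact (frontier V) :=
    hVc.of_isClosed_subset isClosed_frontier frontier_subset_closure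
  have hcl : ∀ z ∈ frontier V, z ∈ closure D → z ∈ D := fun z hz hzD => by
    by_contra hn
    exact hVF.le_bot ⟨hz, by rw [hDo.frontier_eq]; exact ⟨hzD, hn⟩⟩
  have hJ : IsCompact (frontier V ∩ closure D) := hfV.inter_right isClosed_closure
  have hJ' : IsCompact (frontier V ∩ Dᶜ) := hfV.inter_right hDo.isClosed_compl
  refine ⟨frontier V ∩ closure D, hJ, fun z hz => hcl z hz.1 hz.2, fun hz => ?_⟩
  have hz' : z₂ ∈ connectedComponentIn (frontier V ∩ Dᶜ)ᶜ z₁ :=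
    hDc.closure.subset_connectedComponentIn (frontier_subset_closure h₁)
      (subset_compl_iff_disjoint_right.2 (disjoint_left.2 fun z hz hz' => hz'.2 (hcl z hz'.1 hz)))
      (frontier_subset_closure h₂)
  have hun := mem_connectedComponentIn_compl_union hJ hJ'
    (disjoint_left.2 fun z hz hz' => hz'.2 (hcl z hz.1 hz.2)) hz hz'
  have hsub : frontier V ⊆ frontier V ∩ closure D ∪ frontier V ∩ Dᶜ := fun z hz => by
    by_cases hzD : z ∈ D
    · exact Or.inl ⟨hz, subset_closure hzD⟩
    · exact Or.inr ⟨hz, hzD⟩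
  have hzV := connectedComponentIn_mono z₁ (compl_subset_compl.2 hsub) hun
  have h1V : z₁ ∈ V := hAV (h1A rfl)
  have h2V : z₂ ∈ V := isPreconnected_connectedComponentIn.subset_of_disjoint_frontier
    (disjoint_compl_left.mono_left (connectedComponentIn_subset _ _))
    (mem_connectedComponentIn (fun h' => by rw [hVo.frontier_eq] at h'; exact h'.2 h1V)) h1V hzV
  exact hVB (subset_closure h2V) h2B

/-! ### From a continuous extension to a Peano compactum -/

theorem IsHomeoOnto.notMem_of_tendsto {D Ω : Set ℂ} {φ : ℂ → ℂ} (hφ : IsHomeoOnto φ D Ω)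
    (hΩ : IsOpen Ω) {ι : Type*} {l : Filter ι} [l.NeBot] {u : ι → ℂ} {z w : ℂ}
    (hu : ∀ᶠ i in l, u i ∈ D) (huz : Tendsto u l (𝓝 z)) (hz : z ∉ D)
    (hw : Tendsto (φ ∘ u) l (𝓝 w)) : w ∉ Ω := by
  intro hwΩ
  obtain ⟨-, hbij, ψ, hψ, hinv⟩ := hφ
  have h1 : Tendsto (ψ ∘ φ ∘ u) l (𝓝 (ψ w)) :=
    ((hψ.continuousAt (hΩ.mem_nhds hwΩ)).tendsto).comp hw
  have h2 : Tendsto u l (𝓝 (ψ w)) :=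
    h1.congr' (hu.mono fun i hi => hinv.1 hi)
  rw [tendsto_nhds_unique huz h2] at hz
  obtain ⟨x, hx, rfl⟩ := hbij.surjOn hwΩ
  exact hz (by rwa [hinv.1 hx])

theorem ExtendsContinuously.tendsto {D Ω : Set ℂ} {φ φb : ℂ → ℂ}
    (h : ExtendsContinuously φ φb D Ω) {z : ℂ} (hz : z ∈ closure D) :
    Tendsto φ (𝓝[D] z) (𝓝 (φb z)) :=
  ((h.1 z hz).mono subset_closure).tendsto.congr' (h.2.1.eventuallyEq_of_mem self_mem_nhdsWithin)

theorem ExtendsContinuously.mapsTo_frontier {D Ω : Set ℂ} {φ φb : ℂ → ℂ}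
    (hφ : IsHomeoOnto φ D Ω) (hD : IsOpen D) (hΩ : IsOpen Ω)
    (h : ExtendsContinuously φ φb D Ω) : MapsTo φb (frontier D) (frontier Ω) := by
  intro z hz
  rw [hD.frontier_eq] at hz
  rw [hΩ.frontier_eq]
  have := mem_closure_iff_nhdsWithin_neBot.1 hz.1
  exact ⟨h.2.2 hz.1, hφ.notMem_of_tendsto hΩ (l := 𝓝[D] z) (u := id) self_mem_nhdsWithin
    (tendsto_id.mono_left nhdsWithin_le_nhds) hz.2 (h.tendsto hz.1)⟩

theorem ExtendsContinuously.image_frontier {D Ω : Set ℂ} {φ φb : ℂ → ℂ}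
    (hφ : IsHomeoOnto φ D Ω) (hD : IsOpen D) (hDb : Bornology.IsBounded D) (hΩ : IsOpen Ω)
    (h : ExtendsContinuously φ φb D Ω) : φb '' frontier D = frontier Ω := by
  refine (mapsTo_frontier hφ hD hΩ h).image_subset.antisymm fun w hw => ?_
  have hcl : closure Ω ⊆ φb '' closure D := by
    refine closure_minimal ?_ (hDb.isCompact_closure.image_of_continuousOn h.1).isClosed
    rw [← hφ.2.1.image_eq, ← h.2.1.image_eq]
    exact image_mono subset_closure
  rw [hΩ.frontier_eq] at hw
  obtain ⟨z, hz, rfl⟩ := hcl hw.1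
  refine ⟨z, ?_, rfl⟩
  rw [hD.frontier_eq]
  refine ⟨hz, fun hzD => hw.2 ?_⟩
  rw [h.2.1 hzD]
  exact hφ.2.1.mapsTo hzD

theorem ExtendsContinuously.mem_connectedComponentIn_frontier {D Ω : Set ℂ} {φ φb : ℂ → ℂ}
    (hφ : IsHomeoOnto φ D Ω) (hD : IsOpen D) (hDc : IsPreconnected D)
    (hDb : Bornology.IsBounded D) (hΩ : IsOpen Ω) (hΩc : IsPreconnected Ω)
    (hΩb : Bornology.IsBounded Ω) (h : ExtendsContinuously φ φb D Ω) {z₁ z₂ : ℂ}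
    (h₁ : z₁ ∈ frontier D) (h₂ : z₂ ∈ frontier D)
    (hw : φb z₂ ∈ connectedComponentIn (frontier Ω) (φb z₁)) :
    z₂ ∈ connectedComponentIn (frontier D) z₁ := by
  by_contra hz
  obtain ⟨J, hJ, hJD, hJz⟩ := exists_isCompact_separating hD hDc hDb h₁ h₂ hz
  have hP : IsCompact (φ '' J) := hJ.image_of_continuousOn (hφ.1.mono hJD)
  have hPΩ : φ '' J ⊆ Ω := (image_mono hJD).trans hφ.2.1.image_eq.subset
  have hPF : Disjoint (φ '' J) (frontier Ω) := by
    rw [hΩ.frontier_eq]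
    exact disjoint_left.2 fun w hw hw' => hw'.2 (hPΩ hw)
  have hFc : IsCompact (frontier Ω) :=
    hΩb.isCompact_closure.of_isClosed_subset isClosed_frontier frontier_subset_closure
  set W := connectedComponentIn (φ '' J)ᶜ (φb z₁)
  have hW2 : φb z₂ ∈ W := connectedComponentIn_mono _ hPF.subset_compl_left hw
  have hW1 : φb z₁ ∈ W :=
    mem_connectedComponentIn (hPF.subset_compl_left (mapsTo_frontier hφ hD hΩ h h₁))
  have hWo : IsOpen W := hP.isClosed.isOpen_compl.connectedComponentIn
  have hJF : ∀ z ∈ frontier D, z ∈ Jᶜ := fun z hz hzJ => by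
    rw [hD.frontier_eq] at hz
    exact hz.2 (hJD hzJ)
  have hq : ∀ z ∈ frontier D, φb z ∈ W →
      ∃ q ∈ D, q ∈ connectedComponentIn Jᶜ z ∧ φ q ∈ W := by
    intro z hz hzW
    have hcl := frontier_subset_closure hz
    have := mem_closure_iff_nhdsWithin_neBot.1 hcl
    have h1 : ∀ᶠ q in 𝓝[D] z, φ q ∈ W := (h.tendsto hcl).eventually (hWo.mem_nhds hzW)
    have h2 : ∀ᶠ q in 𝓝[D] z, q ∈ connectedComponentIn Jᶜ z :=
      nhdsWithin_le_nhds ((hJ.isClosed.isOpen_compl.connectedComponentIn).mem_nhds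
        (mem_connectedComponentIn (hJF z hz)))
    obtain ⟨q, hqD, hqW, hqJ⟩ :=
      ((eventually_mem_nhdsWithin).and (h1.and h2)).exists
    exact ⟨q, hqD, hqJ, hqW⟩
  obtain ⟨q₁, hq1D, hq1J, hq1W⟩ := hq z₁ h₁ hW1
  obtain ⟨q₂, hq2D, hq2J, hq2W⟩ := hq z₂ h₂ hW2
  have hp1 : φ q₁ ∈ Ω := hφ.2.1.mapsTo hq1D
  have hp2 : φ q₂ ∈ Ω := hφ.2.1.mapsTo hq2D
  have hΩF : Ω ⊆ (frontier Ω)ᶜ := fun w hw hw' => by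
    rw [hΩ.frontier_eq] at hw'
    exact hw'.2 hw
  have hC := mem_connectedComponentIn_compl_union hP hFc hPF
    (by rw [← connectedComponentIn_eq hq1W]; exact hq2W)
    (hΩc.subset_connectedComponentIn hp1 hΩF hp2)
  set C := connectedComponentIn (φ '' J ∪ frontier Ω)ᶜ (φ q₁)
  have hCsub : C ⊆ (φ '' J ∪ frontier Ω)ᶜ := connectedComponentIn_subset _ _
  have hpC : φ q₁ ∈ C :=
    mem_connectedComponentIn (connectedComponentIn_nonempty_iff.1 ⟨_, hC⟩)
  have hCΩ : C ⊆ Ω := isPreconnected_connectedComponentIn.subset_of_disjoint_frontier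
    (disjoint_left.2 fun w hw hw' => hCsub hw (Or.inr hw')) hpC hp1
  obtain ⟨-, hbij, ψ, hψ, hinv⟩ := hφ
  have hψC : IsPreconnected (ψ '' C) :=
    isPreconnected_connectedComponentIn.image ψ (hψ.mono hCΩ)
  have hψJ : ψ '' C ⊆ Jᶜ := by
    rintro _ ⟨w, hw, rfl⟩ hwJ
    exact hCsub hw (Or.inl ⟨ψ w, hwJ, hinv.2 (hCΩ hw)⟩)
  have hqq : q₂ ∈ connectedComponentIn Jᶜ q₁ :=
    hψC.subset_connectedComponentIn ⟨_, hpC, hinv.1 hq1D⟩ hψJ ⟨_, hC, hinv.1 hq2D⟩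
  rw [connectedComponentIn_eq hq1J, connectedComponentIn_eq hqq,
    ← connectedComponentIn_eq hq2J] at hJz
  exact hJz (mem_connectedComponentIn (hJF z₂ h₂))

theorem ExtendsContinuously.isPeanoCompactum {D Ω : Set ℂ} {φ φb : ℂ → ℂ}
    (hφ : IsHomeoOnto φ D Ω) (hD : IsOpen D) (hDc : IsPreconnected D)
    (hDb : Bornology.IsBounded D) (hΩ : IsOpen Ω) (hΩc : IsPreconnected Ω)
    (hΩb : Bornology.IsBounded Ω) (h : ExtendsContinuously φ φb D Ω)
    (hP : IsPeanoCompactum (frontier D)) : IsPeanoCompactum (frontier Ω) := by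
  have himg := image_frontier hφ hD hDb hΩ h
  have hcont : ContinuousOn φb (frontier D) := h.1.mono frontier_subset_closure
  have hcomp : ∀ z ∈ frontier D,
      connectedComponentIn (frontier Ω) (φb z) = φb '' connectedComponentIn (frontier D) z := by
    intro z hz
    refine Subset.antisymm (fun w hw => ?_) ?_
    · obtain ⟨y, hy, rfl⟩ := himg.symm.subset (connectedComponentIn_subset _ _ hw)
      exact ⟨y, mem_connectedComponentIn_frontier hφ hD hDc hDb hΩ hΩc hΩb h hz hy hw, rfl⟩
    · exact (isPreconnected_connectedComponentIn.image φb
        (hcont.mono (connectedComponentIn_subset _ _))).subset_connectedComponentIn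
        ⟨z, mem_connectedComponentIn hz, rfl⟩
        ((image_mono (connectedComponentIn_subset _ _)).trans himg.subset)
  have hcpt : ∀ z ∈ frontier D, IsCompact (connectedComponentIn (frontier D) z) := fun z hz => by
    rw [connectedComponentIn_eq_image hz]
    have := isCompact_iff_compactSpace.1 hP.1
    exact isClosed_connectedComponent.isCompact.image continuous_subtype_val
  refine ⟨hΩb.isCompact_closure.of_isClosed_subset isClosed_frontier frontier_subset_closure,
    fun w hw => ?_, fun C hC => ?_⟩
  · obtain ⟨z, hz, rfl⟩ := himg.symm.subset hw
    rw [hcomp z hz]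
    set Q := connectedComponentIn (frontier D) z
    have hQc : ContinuousOn φb Q := hcont.mono (connectedComponentIn_subset _ _)
    have := hP.2.1 z hz
    have : CompactSpace Q := isCompact_iff_compactSpace.1 (hcpt z hz)
    have hf : Continuous (Q.mapsTo_image φb).restrict :=
      hQc.mapsToRestrict _
    exact (hf.isClosedMap.isQuotientMap hf
      (surjective_mapsTo_image_restrict φb Q)).isCoinducing.locallyConnectedSpace
  · obtain ⟨δ, hδ, hδC⟩ := Metric.uniformContinuousOn_iff.1
      (hDb.isCompact_closure.uniformContinuousOn_of_continuous h.1) C hC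
    refine ((hP.2.2 (δ / 2) (half_pos hδ)).image (fun Q => φb '' Q)).subset ?_
    rintro _ ⟨⟨w, hw, rfl⟩, hlt⟩
    obtain ⟨z, hz, rfl⟩ := himg.symm.subset hw
    refine ⟨connectedComponentIn (frontier D) z, ⟨⟨z, hz, rfl⟩, ?_⟩, (hcomp z hz).symm⟩
    by_contra! hle
    rw [hcomp z hz] at hlt
    refine hlt.not_ge (diam_le_of_forall_dist_le hC.le ?_)
    rintro _ ⟨x, hx, rfl⟩ _ ⟨y, hy, rfl⟩
    have hsub : connectedComponentIn (frontier D) z ⊆ closure D :=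
      (connectedComponentIn_subset _ _).trans frontier_subset_closure
    exact (hδC x (hsub hx) y (hsub hy) (((dist_le_diam_of_mem (hcpt z hz).isBounded hx hy).trans
      hle).trans_lt (half_lt_self hδ))).le

theorem ExtendsContinuously.oscLiminfZero {D Ω : Set ℂ} {φ φb : ℂ → ℂ}
    (h : ExtendsContinuously φ φb D Ω) {z₀ : ℂ} (hz : z₀ ∈ closure D) :
    OscLiminfZero φ D z₀ := by
  refine Tendsto.liminf_eq ?_
  rw [Metric.tendsto_nhds]
  intro ε hε
  have hnear := Metric.tendsto_nhdsWithin_nhds.1 (h.tendsto hz) (ε / 4) (by positivity)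
  obtain ⟨δ, hδ, hδφ⟩ := hnear
  filter_upwards [Ioo_mem_nhdsGT hδ] with r hr
  rw [Real.dist_0_eq_abs, oscDiam, abs_of_nonneg diam_nonneg]
  refine (diam_le_of_subset_closedBall (x := φb z₀) (r := ε / 4) (by positivity) ?_).trans_lt
    (by linarith)
  rintro _ ⟨z, ⟨hzD, hzr⟩, rfl⟩
  exact (hδφ hzD (by rw [mem_sphere.1 hzr]; exact hr.2)).le

/-! ### Local connectivity properties of a domain with Peano boundary -/

theorem IsPreconnected.exists_dist_eq {s : Set ℂ} (hs : IsPreconnected s) {a u v : ℂ}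
    (hu : u ∈ s) (hv : v ∈ s) {r : ℝ} (hur : dist u a ≤ r) (hrv : r ≤ dist v a) :
    ∃ z ∈ s, dist z a = r :=
  hs.intermediate_value hu hv (by fun_prop : Continuous fun z => dist z a).continuousOn ⟨hur, hrv⟩

theorem IsPeanoCompactum.exists_finset_crossing {K : Set ℂ} (hK : IsPeanoCompactum K) (a : ℂ)
    {r₁ r₂ : ℝ} (hr : r₁ < r₂) :
    ∃ P : Finset ℂ, (∀ p ∈ P, p ∈ K ∩ (closedBall a r₂ \ ball a r₁)) ∧
      ∀ t, ∀ u ∈ connectedComponentIn (K ∩ (closedBall a r₂ \ ball a r₁)) t, dist u a = r₁ →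
        ∀ v ∈ connectedComponentIn (K ∩ (closedBall a r₂ \ ball a r₁)) t, dist v a = r₂ →
          ∃ p ∈ P, p ∈ connectedComponentIn (K ∩ (closedBall a r₂ \ ball a r₁)) t := by
  classical
  set T := K ∩ (closedBall a r₂ \ ball a r₁)
  set ρ := (r₁ + r₂) / 2 with hρ
  have hfin := hK.2.2 ((r₂ - r₁) / 2) (by linarith)
  set 𝒬 := {Q : Set ℂ | (∃ x ∈ K, Q = connectedComponentIn K x) ∧ (r₂ - r₁) / 2 < diam Q}
  have hcov : ∀ Q ∈ 𝒬, ∃ P : Finset ℂ, (∀ p ∈ P, p ∈ Q ∩ sphere a ρ) ∧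
      ∀ q ∈ Q ∩ sphere a ρ, ∃ p ∈ P, p ∈ connectedComponentIn T q := by
    rintro _ ⟨⟨x, hx, rfl⟩, -⟩
    set Q := connectedComponentIn K x with hQ
    have := hK.2.1 x hx
    have hQK : Q ⊆ K := connectedComponentIn_subset _ _
    have hQc : IsCompact Q := by
      rw [hQ, connectedComponentIn_eq_image hx]
      have := isCompact_iff_compactSpace.1 hK.1
      exact isClosed_connectedComponent.isCompact.image continuous_subtype_val
    have hnhds : ∀ p ∈ Q ∩ sphere a ρ, ∃ O ∈ 𝓝 p, ∀ q ∈ O ∩ Q, p ∈ connectedComponentIn T q := by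
      rintro p ⟨hpQ, hpρ⟩
      have hη : 0 < (r₂ - r₁) / 2 := by linarith
      set F : Set Q := (↑) ⁻¹' ball p ((r₂ - r₁) / 2)
      have hF : F ∈ 𝓝 (⟨p, hpQ⟩ : Q) :=
        continuous_subtype_val.continuousAt.preimage_mem_nhds (ball_mem_nhds p hη)
      obtain ⟨O, hO, hON⟩ := mem_nhds_subtype _ _ _ |>.1 (connectedComponentIn_mem_nhds hF)
      refine ⟨O, hO, fun q hq => ?_⟩
      refine (isPreconnected_connectedComponentIn.image ((↑) : Q → ℂ)
        continuous_subtype_val.continuousOn).subset_connectedComponentIn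
        (s := Subtype.val '' connectedComponentIn F (⟨p, hpQ⟩ : Q))
        ⟨⟨q, hq.2⟩, hON hq.1, rfl⟩ ?_
        ⟨⟨p, hpQ⟩, mem_connectedComponentIn (mem_ball_self hη), rfl⟩
      rintro _ ⟨y, hy, rfl⟩
      have hyp : dist (y : ℂ) p < (r₂ - r₁) / 2 := mem_ball.1 (show (y : ℂ) ∈ ball p _ from
        connectedComponentIn_subset F _ hy)
      have h1 := dist_triangle (y : ℂ) p a
      have h2 := dist_triangle p (y : ℂ) a
      rw [dist_comm p (y : ℂ)] at h2
      rw [mem_sphere] at hpρ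
      refine ⟨hQK y.2, mem_closedBall.2 (by linarith), fun hyb => ?_⟩
      rw [mem_ball] at hyb
      linarith
    choose! O hO hOQ using hnhds
    obtain ⟨P, hP, hPc⟩ := (hQc.inter_right isClosed_sphere).elim_nhds_subcover O hO
    refine ⟨P, hP, fun q hq => ?_⟩
    obtain ⟨p, hp, hqp⟩ := mem_iUnion₂.1 (hPc hq)
    exact ⟨p, hp, hOQ p (hP p hp) q ⟨hqp, hq.1⟩⟩
  choose! P hP hPc using hcov
  refine ⟨hfin.toFinset.biUnion P, fun p hp => ?_, fun t u hu hua v hv hva => ?_⟩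
  · obtain ⟨Q, hQ, hpQ⟩ := Finset.mem_biUnion.1 hp
    rw [hfin.mem_toFinset] at hQ
    obtain ⟨h1, h2⟩ := hP Q hQ p hpQ
    obtain ⟨⟨x, -, rfl⟩, -⟩ := hQ
    rw [mem_sphere] at h2
    refine ⟨connectedComponentIn_subset _ _ h1, mem_closedBall.2 (by linarith), fun hb => ?_⟩
    rw [mem_ball] at hb
    linarith
  · set Z := connectedComponentIn T t with hZ
    obtain ⟨z, hz, hza⟩ := isPreconnected_connectedComponentIn.exists_dist_eq (r := ρ) hu hv
      (by linarith) (by linarith)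
    have hZK : Z ⊆ K := (connectedComponentIn_subset _ _).trans inter_subset_left
    have hZQ : Z ⊆ connectedComponentIn K z :=
      isPreconnected_connectedComponentIn.subset_connectedComponentIn hz hZK
    have hQ : connectedComponentIn K z ∈ 𝒬 := by
      refine ⟨⟨z, hZK hz, rfl⟩, ?_⟩
      have h1 := dist_le_diam_of_mem
        (hK.1.isBounded.subset (connectedComponentIn_subset K z)) (hZQ hv) (hZQ hu)
      have h2 := dist_triangle v u a
      linarith
    obtain ⟨p, hp, hpz⟩ := hPc _ hQ z ⟨hZQ hz, hza⟩
    refine ⟨p, Finset.mem_biUnion.2 ⟨_, hfin.mem_toFinset.2 hQ, hp⟩, ?_⟩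
    rw [hZ, connectedComponentIn_eq (show z ∈ connectedComponentIn T t from hz)]
    exact hpz

theorem exp_sum_int_mul {ι : Type*} (s : Finset ι) (c : ι → ℤ) (L : ι → ℂ) :
    Complex.exp (∑ j ∈ s, c j * L j) = ∏ j ∈ s, Complex.exp (L j) ^ c j := by
  simp_rw [Complex.exp_sum, Complex.exp_int_mul]

/-- An integer relation between the rational functions `(z - b j) / (z - b₀)`, modulo exponentials
on a compact set, is trivial at each point `b j` whose complementary component is bounded and
contains none of the other points. -/
theorem eq_zero_of_exp_eq_prod_zpow {ι : Type*} [Fintype ι] {X : Set ℂ} (hX : IsClosed X)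
    {b : ι → ℂ} {b₀ : ℂ} {c : ι → ℤ} {L : ℂ → ℂ} (hb : ∀ k, b k ∉ X) (hb₀ : b₀ ∉ X) (j : ι)
    (hbd : Bornology.IsBounded (connectedComponentIn Xᶜ (b j)))
    (hj : ∀ k ≠ j, b k ∉ connectedComponentIn Xᶜ (b j))
    (hj₀ : b₀ ∉ connectedComponentIn Xᶜ (b j)) (hL : ContinuousOn L X)
    (h : ∀ z ∈ X, Complex.exp (L z) = ∏ k, ((z - b k) / (z - b₀)) ^ c k) : c j = 0 := by
  classical
  have hne₀ : ∀ z ∈ closure (connectedComponentIn Xᶜ (b j)), z - b₀ ≠ 0 := fun z hz h' =>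
    disjoint_closure_connectedComponentIn_compl hX hb₀ hj₀ (by rwa [← sub_eq_zero.1 h'])
  have hne : ∀ k ≠ j, ∀ z ∈ closure (connectedComponentIn Xᶜ (b j)), z - b k ≠ 0 :=
    fun k hk z hz h' =>
    disjoint_closure_connectedComponentIn_compl hX (hb k) (hj k hk) (by rwa [← sub_eq_zero.1 h'])
  have hquot : ∀ k ∈ Finset.univ.erase j, ∀ z ∈ closure (connectedComponentIn Xᶜ (b j)),
      (z - b k) / (z - b₀) ≠ 0 := fun k hk z hz =>
    div_ne_zero (hne k (Finset.ne_of_mem_erase hk) z hz) (hne₀ z hz)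
  have hprod0 : ∀ z ∈ closure (connectedComponentIn Xᶜ (b j)),
      (∏ k ∈ Finset.univ.erase j, ((z - b k) / (z - b₀)) ^ c k) ≠ 0 := fun z hz =>
    Finset.prod_ne_zero_iff.2 fun k hk => zpow_ne_zero _ (hquot k hk z hz)
  refine eq_zero_of_exp_mul_eq_zpow hX (hb j) hbd (L := L)
    (f := fun z => (∏ k ∈ Finset.univ.erase j, ((z - b k) / (z - b₀)) ^ c k)⁻¹ *
      (z - b₀) ^ c j) ?_ ?_ hL ?_
  · refine (ContinuousOn.inv₀ (continuousOn_finsetProd _ fun k hk => ?_) hprod0).mul ?_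
    · exact (ContinuousOn.div (by fun_prop) (by fun_prop) hne₀).zpow₀ _
        fun z hz => Or.inl (hquot k hk z hz)
    · exact ContinuousOn.zpow₀ (by fun_prop) _ fun z hz => Or.inl (hne₀ z hz)
  · exact fun z hz => mul_ne_zero (inv_ne_zero (hprod0 z hz)) (zpow_ne_zero _ (hne₀ z hz))
  · intro z hz
    have hz₀ : z - b₀ ≠ 0 := fun h' => hb₀ (by rwa [← sub_eq_zero.1 h'])
    have hzp : (∏ k ∈ Finset.univ.erase j, ((z - b k) / (z - b₀)) ^ c k) ≠ 0 :=
      Finset.prod_ne_zero_iff.2 fun k _ => zpow_ne_zero _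
        (div_ne_zero (fun h' => hb k (by rwa [← sub_eq_zero.1 h'])) hz₀)
    rw [h z hz, ← Finset.mul_prod_erase _ _ (Finset.mem_univ j), div_zpow]
    have := zpow_ne_zero (c j) hz₀
    field_simp

/-- Two logarithms of `h`, one on `K` and one outside `ball a r₁`, which agree on a set meeting
every crossing component of `K` in the annulus, give a logarithm on `K ∩ closedBall a r₂` together
with the outer circle. -/
theorem exists_log_of_crossing {K : Set ℂ} (hK : IsCompact K) {a : ℂ} {r₁ r₂ : ℝ} (hr : r₁ < r₂)
    {P : Finset ℂ}
    (hP : ∀ t, ∀ u ∈ connectedComponentIn (K ∩ (closedBall a r₂ \ ball a r₁)) t, dist u a = r₁ →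
        ∀ v ∈ connectedComponentIn (K ∩ (closedBall a r₂ \ ball a r₁)) t, dist v a = r₂ →
          ∃ p ∈ P, p ∈ connectedComponentIn (K ∩ (closedBall a r₂ \ ball a r₁)) t)
    {g s h : ℂ → ℂ} (hg : ContinuousOn g K) (hs : ContinuousOn s (ball a r₁)ᶜ)
    (hgh : ∀ z ∈ K, Complex.exp (g z) = h z) (hsh : ∀ z ∈ (ball a r₁)ᶜ, Complex.exp (s z) = h z)
    (hgs : ∀ p ∈ P, g p = s p) :
    ∃ L : ℂ → ℂ, ContinuousOn L (K ∩ closedBall a r₂ ∪ sphere a r₂) ∧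
      ∀ z ∈ K ∩ closedBall a r₂ ∪ sphere a r₂, Complex.exp (L z) = h z := by
  classical
  set T := K ∩ (closedBall a r₂ \ ball a r₁) with hTdef
  have hTK : T ⊆ K := inter_subset_left
  have hTs : T ⊆ (ball a r₁)ᶜ := fun z hz => hz.2.2
  have hT : IsCompact T := hK.inter_right (isClosed_closedBall.inter isOpen_ball.isClosed_compl)
  have hTe : ∀ z ∈ T, Complex.exp (g z) = Complex.exp (s z) := fun z hz =>
    (hgh z (hTK hz)).trans (hsh z (hTs hz)).symm
  have hsph : sphere a r₂ ⊆ (ball a r₁)ᶜ := fun z hz hz' => by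
    rw [mem_sphere] at hz
    rw [mem_ball] at hz'
    linarith
  set T₀ := (T ∩ (fun z => ‖g z - s z‖) ⁻¹' Ici 1) ∩ sphere a r₂ with hT₀def
  have hT₀ : IsCompact T₀ :=
    (hT.of_isClosed_subset (((hg.mono hTK).sub (hs.mono hTs)).norm.preimage_isClosed_of_isClosed
      hT.isClosed isClosed_Ici) inter_subset_left).inter_right isClosed_sphere
  have hT₀e : ∀ z ∈ T ∩ sphere a r₂, z ∉ T₀ → g z = s z := fun z hz hz₀ => by
    obtain ⟨n, hn⟩ := Complex.exp_eq_exp_iff_exists_int.1 (hTe z hz.1)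
    have hlt : ‖g z - s z‖ < 1 := lt_of_not_ge fun h' => hz₀ ⟨⟨hz.1, h'⟩, hz.2⟩
    rw [hn, add_sub_cancel_left, norm_mul, Complex.norm_intCast] at hlt
    have h2 : (1 : ℝ) ≤ ‖(2 * Real.pi * Complex.I : ℂ)‖ := by
      simp [abs_of_pos Real.pi_pos]
      linarith [Real.pi_gt_three]
    have h3 : |(n : ℝ)| < 1 := by nlinarith [abs_nonneg (n : ℝ)]
    have h4 : n = 0 := by
      rw [← Int.cast_abs] at h3
      exact Int.abs_lt_one_iff.1 (by exact_mod_cast h3)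
    rw [hn, h4]
    simp
  obtain ⟨A, B, hA, hB, hAB, hABT, hTA, hAs⟩ :=
    hT.exists_separation_of_components hT₀ (T := sphere a r₁) isClosed_sphere
      (fun z hz => hz.1.1) fun t ht => disjoint_left.2 fun u hu hua => by
        have htc := mem_connectedComponentIn ht.1.1
        obtain ⟨p, hp, hpt⟩ := hP t u hu hua t htc ht.2
        have hsub := connectedComponentIn_subset T t
        have := isPreconnected_connectedComponentIn.eqOn_of_exp_eq (hg.mono (hsub.trans hTK))
          (hs.mono (hsub.trans hTs)) (fun z hz => hTe z (hsub hz)) hpt (hgs p hp) htc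
        have h1 : (1 : ℝ) ≤ ‖g t - s t‖ := ht.1.2
        rw [this, sub_self, norm_zero] at h1
        linarith
  have hAT : A ⊆ T := hABT ▸ subset_union_left
  have hBT : B ⊆ T := hABT ▸ subset_union_right
  set Y₁ := A ∪ sphere a r₂ with hY₁
  set Y₂ := (K ∩ closedBall a r₁) ∪ B with hY₂
  have hY₁c : IsClosed Y₁ := hA.isClosed.union isClosed_sphere
  have hY₂c : IsClosed Y₂ := (hK.isClosed.inter isClosed_closedBall).union hB.isClosed
  have hY₁s : Y₁ ⊆ (ball a r₁)ᶜ := union_subset (hAT.trans hTs) hsph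
  have hY₂K : Y₂ ⊆ K := union_subset inter_subset_left (hBT.trans hTK)
  have hYe : ∀ z ∈ Y₁ ∩ Y₂, g z = s z := by
    rintro z ⟨hz | hz, hz' | hz'⟩
    · refine absurd ?_ (disjoint_left.1 hAs hz)
      exact le_antisymm hz'.2 (not_lt.1 (hTs (hAT hz)))
    · exact absurd hz' (disjoint_left.1 hAB hz)
    · have h1 := mem_closedBall.1 hz'.2
      rw [mem_sphere] at hz
      linarith
    · exact hT₀e z ⟨hBT hz', hz⟩ fun h' => disjoint_left.1 hAB (hTA h') hz'
  have hXY : K ∩ closedBall a r₂ ∪ sphere a r₂ ⊆ Y₁ ∪ Y₂ := by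
    rintro z (hz | hz)
    · by_cases hzb : z ∈ ball a r₁
      · exact Or.inr (Or.inl ⟨hz.1, ball_subset_closedBall hzb⟩)
      · have hzT : z ∈ A ∪ B := hABT ▸ ⟨hz.1, hz.2, hzb⟩
        exact hzT.elim (fun h' => Or.inl (Or.inl h')) fun h' => Or.inr (Or.inr h')
    · exact Or.inl (Or.inr hz)
  have hL₂ : EqOn (Y₁.piecewise s g) g Y₂ := fun z hz => by
    by_cases hz₁ : z ∈ Y₁
    · rw [piecewise_eq_of_mem _ _ _ hz₁, hYe z ⟨hz₁, hz⟩]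
    · rw [piecewise_eq_of_notMem _ _ _ hz₁]
  refine ⟨Y₁.piecewise s g, ContinuousOn.mono ?_ hXY, fun z hz => ?_⟩
  · exact ((hs.mono hY₁s).congr (piecewise_eqOn _ _ _)).union_of_isClosed
      ((hg.mono hY₂K).congr hL₂) hY₁c hY₂c
  · by_cases hz₁ : z ∈ Y₁
    · rw [piecewise_eq_of_mem _ _ _ hz₁, hsh z (hY₁s hz₁)]
    · have hz₂ : z ∈ Y₂ := (hXY hz).resolve_left hz₁
      rw [hL₂ hz₂, hgh z (hY₂K hz₂)]

theorem finite_connectedComponentIn_inter_ball {Ω : Set ℂ} (hΩ : IsOpen Ω)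
    (hΩc : IsPreconnected Ω) (hK : IsPeanoCompactum (frontier Ω)) (a : ℂ) {r₁ r₂ : ℝ}
    (hr : r₁ < r₂) :
    {Q : Set ℂ | ∃ y ∈ Ω ∩ ball a r₁, Q = connectedComponentIn (Ω ∩ ball a r₂) y}.Finite := by
  classical
  obtain ⟨P, hPT, hP⟩ := hK.exists_finset_crossing a hr
  by_contra hinf
  set f := Set.Infinite.natEmbedding _ hinf
  have hf : ∀ n, ∃ y ∈ Ω ∩ ball a r₁, (f n : Set ℂ) = connectedComponentIn (Ω ∩ ball a r₂) y :=
    fun n => (f n).2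
  choose y hy hfy using hf
  have hyinj : ∀ k j, y k ∈ connectedComponentIn (Ω ∩ ball a r₂) (y j) → k = j := fun k j h =>
    f.injective <| Subtype.ext <| by rw [hfy, hfy, connectedComponentIn_eq h]
  have hΩK : Disjoint Ω (frontier Ω) := (disjoint_frontier_iff_isOpen.2 hΩ).symm
  have hdisj : Disjoint (ball a r₁) (ball a r₁)ᶜ := disjoint_compl_right
  choose g hg hge using fun j => exists_continuousOn_log_div hΩ hΩc hΩK (hy j).1 (hy 0).1
  choose s hs hse using fun j => exists_continuousOn_log_div isOpen_ball
    (convex_ball a r₁).isPreconnected hdisj (hy j).2 (hy 0).2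
  have hgs : ∀ j, ∀ p ∈ P, ∃ n : ℤ, g j p = s j p + n * (2 * Real.pi * Complex.I) :=
    fun j p hp => Complex.exp_eq_exp_iff_exists_int.1
      ((hge j p (hPT p hp).1).trans (hse j p (hPT p hp).2.2).symm)
  choose! n hn using hgs
  set ι := Fin (P.card + 1)
  set e : ι → ℕ := fun j => j + 1 with he
  have hli : ¬ LinearIndependent ℤ (fun (j : ι) (p : P) => n (e j) p) := fun h => by
    have := h.fintype_card_le_finrank
    simp [ι] at this
  obtain ⟨c, hc, j₀, hj₀⟩ := Fintype.not_linearIndependent_iff.1 hli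
  obtain ⟨L, hL, hLe⟩ := exists_log_of_crossing hK.1 hr hP (g := fun z => ∑ j : ι, c j * g (e j) z)
    (s := fun z => ∑ j : ι, c j * s (e j) z)
    (h := fun z => ∏ j : ι, ((z - y (e j)) / (z - y 0)) ^ c j)
    (continuousOn_finsetSum _ fun j _ => continuousOn_const.mul (hg _))
    (continuousOn_finsetSum _ fun j _ => continuousOn_const.mul (hs _))
    (fun z hz => by
      rw [exp_sum_int_mul]
      exact Finset.prod_congr rfl fun j _ => by rw [hge _ z hz])
    (fun z hz => by
      rw [exp_sum_int_mul]
      exact Finset.prod_congr rfl fun j _ => by rw [hse _ z hz])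
    (fun p hp => by
      have h1 := congrArg (Int.cast : ℤ → ℂ) (congrFun hc ⟨p, hp⟩)
      simp only [Finset.sum_apply, Pi.smul_apply, smul_eq_mul, Int.cast_sum, Int.cast_mul,
        Pi.zero_apply, Int.cast_zero] at h1
      calc ∑ j, (c j : ℂ) * g (e j) p
          = ∑ j, (c j : ℂ) * s (e j) p
            + (∑ j, (c j : ℂ) * n (e j) p) * (2 * Real.pi * Complex.I) := by
            rw [Finset.sum_mul, ← Finset.sum_add_distrib]
            exact Finset.sum_congr rfl fun j _ => by rw [hn _ p hp]; ring
        _ = _ := by rw [h1, zero_mul, add_zero])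
  set X := frontier Ω ∩ closedBall a r₂ ∪ sphere a r₂ with hX
  have hXc : IsClosed X := (isClosed_frontier.inter isClosed_closedBall).union isClosed_sphere
  have hyX : ∀ k, y k ∉ X := by
    rintro k (h | h)
    · exact disjoint_left.1 hΩK (hy k).1 h.1
    · have := mem_ball.1 (hy k).2
      rw [mem_sphere] at h
      linarith
  have hr₂ : 0 < r₂ := (dist_nonneg.trans_lt (mem_ball.1 (hy 0).2)).trans hr
  set U := connectedComponentIn Xᶜ (y (e j₀)) with hU
  have hyU : y (e j₀) ∈ U := mem_connectedComponentIn (hyX _)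
  have hUX : Disjoint U X :=
    subset_compl_iff_disjoint_right.1 (connectedComponentIn_subset _ _)
  have hUc : IsPreconnected U := isPreconnected_connectedComponentIn
  have hUb : U ⊆ ball a r₂ := hUc.subset_ball_of_disjoint_sphere hr₂.ne'
    (hUX.mono_right subset_union_right) hyU (ball_subset_ball hr.le (hy _).2)
  have hUΩ : U ⊆ Ω := hUc.subset_of_disjoint_frontier (disjoint_left.2 fun z hz hz' =>
    disjoint_left.1 hUX hz (Or.inl ⟨hz', ball_subset_closedBall (hUb hz)⟩)) hyU (hy _).1
  have hUy : ∀ k, y k ∈ U → k = e j₀ := fun k hk =>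
    hyinj _ _ (hUc.subset_connectedComponentIn hyU (subset_inter hUΩ hUb) hk)
  exact hj₀ (eq_zero_of_exp_eq_prod_zpow hXc (fun k => hyX _) (hyX 0) j₀
    (isBounded_ball.subset hUb) (fun k hk h => hk (Fin.ext (by simpa [he] using hUy _ h)))
    (fun h => by simpa [he] using hUy _ h) hL hLe)

/-! ### Boundary limits -/

theorem IsHomeoOnto.exists_tendsto_of_oscLiminfZero {φ : ℂ → ℂ} {D Ω : Set ℂ}
    (hφ : IsHomeoOnto φ D Ω) (hD : IsOpen D) (hΩ : IsOpen Ω) (hΩc : IsConnected Ω)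
    (hΩb : Bornology.IsBounded Ω) (hK : IsPeanoCompactum (frontier Ω)) {z₀ : ℂ}
    (hz₀ : z₀ ∈ frontier D) (h : OscLiminfZero φ D z₀) : ∃ w, Tendsto φ (𝓝[D] z₀) (𝓝 w) := by
  have hz₀D : z₀ ∉ D := fun h' => disjoint_left.1 (disjoint_frontier_iff_isOpen.2 hD) hz₀ h'
  obtain ⟨-, hbij, ψ, hψ, hψφ⟩ := hφ
  have hcpt : IsCompact (closure Ω) := hΩb.isCompact_closure
  have hφΩ : ∀ r, φ '' (D ∩ sphere z₀ r) ⊆ Ω := fun r =>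
    image_subset_iff.2 fun z hz => hbij.mapsTo hz.1
  have hfreq : ∀ ε > 0, ∃ᶠ r in 𝓝[>] (0 : ℝ), oscDiam φ D z₀ r < ε := fun ε hε =>
    frequently_lt_of_liminf_lt
      (isCoboundedUnder_ge_of_le _ fun r => diam_mono (hφΩ r) hΩb) (h.trans_lt hε)
  have hseq : ∀ n : ℕ, ∃ r : ℝ, ∃ w ∈ Ω, 0 < r ∧ r < 1 / (n + 1) ∧
      ∀ z ∈ D, dist z z₀ = r → dist (φ z) w < 1 / (n + 1) := fun n => by
    have hn : (0 : ℝ) < 1 / (n + 1) := Nat.one_div_pos_of_nat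
    obtain ⟨r, hr, hr'⟩ := ((hfreq _ hn).and_eventually (Ioo_mem_nhdsGT hn)).exists
    obtain hem | ⟨u, hu⟩ := (D ∩ sphere z₀ r).eq_empty_or_nonempty
    · obtain ⟨w, hw⟩ := hΩc.nonempty
      exact ⟨r, w, hw, hr'.1, hr'.2, fun z hz hzr =>
        absurd (hem.subset <| show z ∈ D ∩ sphere z₀ r from ⟨hz, hzr⟩) (notMem_empty z)⟩
    · exact ⟨r, φ u, hbij.mapsTo hu.1, hr'.1, hr'.2, fun z hz hzr =>
        (dist_le_diam_of_mem (hΩb.subset (hφΩ r)) (mem_image_of_mem φ ⟨hz, hzr⟩)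
          (mem_image_of_mem φ hu)).trans_lt hr⟩
  choose r w hw hr hrn hrw using hseq
  have hone : Tendsto (fun n : ℕ => (1 : ℝ) / (n + 1)) atTop (𝓝 0) :=
    tendsto_one_div_add_atTop_nhds_zero_nat
  obtain ⟨w₀, -, σ, hσ, hwσ⟩ := hcpt.tendsto_subseq fun n => subset_closure (hw n)
  refine ⟨w₀, hcpt.tendsto_nhds_of_unique_mapClusterPt
    (eventually_mem_nhdsWithin.mono fun z hz => subset_closure (hbij.mapsTo hz))
    fun a _ ha => ?_⟩
  by_contra hne
  set ρ := dist a w₀ / 3 with hρ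
  have hρ0 : 0 < ρ := div_pos (dist_pos.2 hne) three_pos
  have hfin := finite_connectedComponentIn_inter_ball hΩ hΩc.isPreconnected hK a
    (half_lt_self hρ0)
  have hfr : ∃ᶠ z in 𝓝[D] z₀, φ z ∈ ball a (ρ / 2) :=
    ha.frequently (ball_mem_nhds a (half_pos hρ0))
  obtain ⟨V, hVS, hV⟩ : ∃ V ∈ {Q : Set ℂ | ∃ y ∈ Ω ∩ ball a (ρ / 2),
      Q = connectedComponentIn (Ω ∩ ball a ρ) y}, ∃ᶠ z in 𝓝[D] z₀, φ z ∈ V := by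
    by_contra! hcon
    have hev := (eventually_all_finite hfin).2 hcon
    obtain ⟨z, hz, hz', hzD⟩ := (hfr.and_eventually (hev.and eventually_mem_nhdsWithin)).exists
    have hzΩ := hbij.mapsTo hzD
    exact hz' _ ⟨φ z, ⟨hzΩ, hz⟩, rfl⟩
      (mem_connectedComponentIn ⟨hzΩ, ball_subset_ball (half_le_self hρ0.le) hz⟩)
  obtain ⟨v, hv, hVeq⟩ := hVS
  have hVsub : V ⊆ Ω ∩ ball a ρ := hVeq ▸ connectedComponentIn_subset _ _
  have hVc : IsPreconnected V := hVeq ▸ isPreconnected_connectedComponentIn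
  have hvV : v ∈ V :=
    hVeq ▸ mem_connectedComponentIn ⟨hv.1, ball_subset_ball (half_le_self hρ0.le) hv.2⟩
  have hψV : IsPreconnected (ψ '' V) :=
    hVc.image ψ (hψ.mono (hVsub.trans inter_subset_left))
  have hψD : ∀ y ∈ Ω, ψ y ∈ D := fun y hy => by
    obtain ⟨z, hz, rfl⟩ := hbij.surjOn hy
    rwa [hψφ.1 hz]
  have hη : 0 < dist (ψ v) z₀ := dist_pos.2 fun h' => hz₀D (h' ▸ hψD v hv.1)
  have hσ' := hone.comp hσ.tendsto_atTop
  obtain ⟨n, hn₁, hn₂, hn₃⟩ := ((hσ'.eventually_lt_const hη).and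
    ((hσ'.eventually_lt_const hρ0).and (hwσ (ball_mem_nhds w₀ hρ0)))).exists
  obtain ⟨z, hzV, hzr, hzD⟩ := (hV.and_eventually
    ((eventually_nhdsWithin_of_eventually_nhds (ball_mem_nhds z₀ (hr (σ n)))).and
      eventually_mem_nhdsWithin)).exists
  obtain ⟨_, ⟨y, hy, rfl⟩, hyr⟩ := hψV.exists_dist_eq (a := z₀) (r := r (σ n))
    ⟨φ z, hzV, hψφ.1 hzD⟩ (mem_image_of_mem ψ hvV) (mem_ball.1 hzr).le
    ((hrn _).le.trans hn₁.le)
  have hyΩ := hVsub hy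
  have h1 := hrw (σ n) _ (hψD y hyΩ.1) hyr
  rw [hψφ.2 hyΩ.1] at h1
  have h2 := mem_ball.1 hyΩ.2
  have h3 : dist (w (σ n)) w₀ < ρ := hn₃
  have h4 := dist_triangle4 a y (w (σ n)) w₀
  rw [dist_comm a y] at h4
  have h5 : (1 : ℝ) / ((σ n : ℕ) + 1) < ρ := hn₂
  linarith

theorem exists_extendsContinuously {φ : ℂ → ℂ} {D Ω : Set ℂ}
    (hφ : ContinuousOn φ D) (hφΩ : MapsTo φ D Ω)
    (h : ∀ z ∈ frontier D, ∃ w, Tendsto φ (𝓝[D] z) (𝓝 w)) :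
    ∃ φb, ExtendsContinuously φ φb D Ω := by
  have hlim : ∀ z ∈ closure D, ∃ w, Tendsto φ (𝓝[D] z) (𝓝 w) := fun z hz => by
    by_cases hzD : z ∈ D
    · exact ⟨_, hφ z hzD⟩
    · exact h z ⟨hz, fun hi => hzD (interior_subset hi)⟩
  refine ⟨extendFrom D φ, continuousOn_extendFrom subset_rfl hlim, fun z hz => ?_, fun z hz => ?_⟩
  · exact extendFrom_eq (subset_closure hz) (hφ z hz)
  · obtain ⟨w, hw⟩ := hlim z hz
    have := mem_closure_iff_nhdsWithin_neBot.1 hz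
    rw [extendFrom_eq hz hw]
    exact mem_closure_of_tendsto hw (eventually_mem_nhdsWithin.mono fun y hy => hφΩ hy)

/-- Theorem A (topological Carathéodory continuity theorem). -/
theorem stmt_0 (D Ω : Set ℂ) (φ : ℂ → ℂ)
    (hD : IsGeneralizedJordanDomain D)
    (hΩ : IsPlanarDomain Ω) (hΩb : Bornology.IsBounded Ω)
    (hφ : IsHomeoOnto φ D Ω) :
    (∃ φb : ℂ → ℂ, ExtendsContinuously φ φb D Ω) ↔
      (IsPeanoCompactum (frontier Ω) ∧ ∀ z₀ ∈ frontier D, OscLiminfZero φ D z₀) := by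
  obtain ⟨⟨-, hDo, hDc⟩, hDb, hDP, -⟩ := hD
  obtain ⟨-, hΩo, hΩc⟩ := hΩ
  constructor
  · rintro ⟨φb, h⟩
    exact ⟨ExtendsContinuously.isPeanoCompactum hφ hDo hDc.isPreconnected hDb hΩo
      hΩc.isPreconnected hΩb h hDP, fun z₀ hz₀ => h.oscLiminfZero (frontier_subset_closure hz₀)⟩
  · rintro ⟨hP, hosc⟩
    exact exists_extendsContinuously hφ.1 hφ.2.1.mapsTo fun z₀ hz₀ =>
      hφ.exists_tendsto_of_oscLiminfZero hDo hΩo hΩc hΩb hP hz₀ (hosc z₀ hz₀)
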